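/- arXiv:2407.05146 — 11 statements merged into one kernel-verified Lean document; each statement's English description precedes it below -/
import Mathlib

section
/- Under Uniswap V3 with liquidity L > 0 in the range [p_a, p_b], 0 < p_a < p_b, initial price p₀ ∈ (p_a, p_b) and current price p_t > 0, the funded P&L, defined as P&L_funded(p_t) = (p_t·x_t + y_t) − (p₀·x₀ + y₀), equals: L·[2·(√p_t − √p₀) + (p₀ − p_t)/√p_b] if p_t ∈ (p_a, p_b); L·[p_t·(1/√p_a − 1/√p_b) + p₀/√p_b − 2·√p₀ + √p_a] if p_t ≤ p_a; and L·[√p_b + p₀/√p_b − 2·√p₀] if p_t ≥ p_b. -/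
/-- Uniswap V3 reserves of token 1 at price `p` for liquidity `L` on the range `[pa, pb]`. -/
noncomputable def v3x (L pa pb p : ℝ) : ℝ :=
  if p ≤ pa then L * (1 / Real.sqrt pa - 1 / Real.sqrt pb)
  else if p < pb then L * (1 / Real.sqrt p - 1 / Real.sqrt pb)
  else 0

/-- Uniswap V3 reserves of token 2 at price `p` for liquidity `L` on the range `[pa, pb]`. -/
noncomputable def v3y (L pa pb p : ℝ) : ℝ :=
  if p ≤ pa then 0
  else if p < pb then L * (Real.sqrt p - Real.sqrt pa)
  else L * (Real.sqrt pb - Real.sqrt pa)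

/-- The value, in units of token 2, of a position whose price lies inside its range. -/
theorem v3_value_of_mem_range {L pa pb p : ℝ} (ha : pa < p) (hb : p < pb) :
    p * v3x L pa pb p + v3y L pa pb p
      = L * (2 * Real.sqrt p - p / Real.sqrt pb - Real.sqrt pa) := by
  simp only [v3x, v3y, if_neg ha.not_ge, if_pos hb]
  linear_combination L * Real.div_sqrt (x := p)

/-- Uniswap V3 funded P&L: with liquidity `L > 0` on `[pa, pb]`, `0 < pa < pb`,
initial price `p₀ ∈ (pa, pb)` and current price `pₜ > 0`, the funded P&L
`(pₜ xₜ + yₜ) − (p₀ x₀ + y₀)` equals `L [2(√pₜ − √p₀) + (p₀ − pₜ)/√pb]` if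
`pₜ ∈ (pa, pb)`, `L [pₜ (1/√pa − 1/√pb) + p₀/√pb − 2√p₀ + √pa]` if `pₜ ≤ pa`, and
`L [√pb + p₀/√pb − 2√p₀]` if `pₜ ≥ pb`. -/
theorem uniswapV3_funded_pnl (L pa pb p₀ pₜ : ℝ) (hL : 0 < L) (hpa : 0 < pa)
    (hab : pa < pb) (hp₀a : pa < p₀) (hp₀b : p₀ < pb) (hpₜ : 0 < pₜ)
    (PnL : ℝ)
    (hPnL : PnL = (pₜ * v3x L pa pb pₜ + v3y L pa pb pₜ)
      - (p₀ * v3x L pa pb p₀ + v3y L pa pb p₀)) :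
    (pa < pₜ → pₜ < pb →
      PnL = L * (2 * (Real.sqrt pₜ - Real.sqrt p₀) + (p₀ - pₜ) / Real.sqrt pb)) ∧
    (pₜ ≤ pa →
      PnL = L * (pₜ * (1 / Real.sqrt pa - 1 / Real.sqrt pb)
        + p₀ / Real.sqrt pb - 2 * Real.sqrt p₀ + Real.sqrt pa)) ∧
    (pb ≤ pₜ →
      PnL = L * (Real.sqrt pb + p₀ / Real.sqrt pb - 2 * Real.sqrt p₀)) := by
  rw [v3_value_of_mem_range hp₀a hp₀b] at hPnL
  subst hPnL
  refine ⟨fun ha hb => ?_, fun ha => ?_, fun hb => ?_⟩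
  · rw [v3_value_of_mem_range ha hb]
    ring
  · simp only [v3x, v3y, if_pos ha]
    ring
  · simp only [v3x, v3y, if_neg (hab.trans_le hb).not_ge, if_neg hb.not_gt]
    ring
end

section
/- Under Uniswap V3 with range [p_a, p_b], 0 < p_a < p_b, initial price p₀ ∈ (p_a, p_b) and any current price p_t > 0, the payoff of the IL protection claim for the funded LP, defined as the negative of the funded P&L divided by the initial value, satisfies the compact formula −P&L_funded(p_t)/(p₀·x₀ + y₀) = −( p_t/√f(p_t) + √f(p_t) − p_t/√p_b − √p_a ) / ( p₀/√f(p₀) + √f(p₀) − p₀/√p_b − √p_a ) + 1, where f(x) = max(min(x, p_b), p_a). -/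
/-- The price clamped to the range `[pa, pb]`: `f(x) = max(min(x, pb), pa)`. -/
noncomputable def clampPrice (pa pb x : ℝ) : ℝ := max (min x pb) pa

theorem v3_value_eq (L p : ℝ) {pa pb : ℝ} (hab : pa < pb) :
    p * v3x L pa pb p + v3y L pa pb p =
      L * (p / Real.sqrt (clampPrice pa pb p) + Real.sqrt (clampPrice pa pb p)
        - p / Real.sqrt pb - Real.sqrt pa) := by
  unfold v3x v3y clampPrice
  split_ifs with h₁ h₂
  · rw [min_eq_left (h₁.trans hab.le), max_eq_right h₁]
    ring
  · rw [min_eq_left h₂.le, max_eq_left (not_le.mp h₁).le]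
    ring
  · rw [min_eq_right (not_lt.mp h₂), max_eq_left hab.le]
    ring

theorem v3_value_factor_pos {pa pb p : ℝ} (hpa : 0 < pa) (ha : pa < p) (hb : p < pb) :
    0 < p / Real.sqrt (clampPrice pa pb p) + Real.sqrt (clampPrice pa pb p)
      - p / Real.sqrt pb - Real.sqrt pa := by
  have hp : 0 < p := hpa.trans ha
  rw [clampPrice, min_eq_left hb.le, max_eq_left ha.le]
  have h₁ : Real.sqrt pa < Real.sqrt p := Real.sqrt_lt_sqrt hpa.le ha
  have h₂ : p / Real.sqrt pb < p / Real.sqrt p :=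
    div_lt_div_of_pos_left hp (Real.sqrt_pos.mpr hp) (Real.sqrt_lt_sqrt hp.le hb)
  linarith

/-- Payoff of the IL protection claim for the funded Uniswap V3 LP: with
`0 < pa < pb`, initial price `p₀ ∈ (pa, pb)` and any current price `pₜ > 0`,
the negative of the funded P&L divided by the initial value satisfies
`−P&L(pₜ)/(p₀ x₀ + y₀)
  = −(pₜ/√f(pₜ) + √f(pₜ) − pₜ/√pb − √pa)/(p₀/√f(p₀) + √f(p₀) − p₀/√pb − √pa) + 1`,
where `f(x) = max(min(x, pb), pa)`. -/
theorem uniswapV3_funded_protection_payoff (L pa pb p₀ pₜ : ℝ) (hL : 0 < L) (hpa : 0 < pa)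
    (hab : pa < pb) (hp₀a : pa < p₀) (hp₀b : p₀ < pb) (hpₜ : 0 < pₜ)
    (PnL : ℝ)
    (hPnL : PnL = (pₜ * v3x L pa pb pₜ + v3y L pa pb pₜ)
      - (p₀ * v3x L pa pb p₀ + v3y L pa pb p₀)) :
    -PnL / (p₀ * v3x L pa pb p₀ + v3y L pa pb p₀) =
      -((pₜ / Real.sqrt (clampPrice pa pb pₜ) + Real.sqrt (clampPrice pa pb pₜ)
          - pₜ / Real.sqrt pb - Real.sqrt pa)
        / (p₀ / Real.sqrt (clampPrice pa pb p₀) + Real.sqrt (clampPrice pa pb p₀)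
          - p₀ / Real.sqrt pb - Real.sqrt pa)) + 1 := by
  have hne := (v3_value_factor_pos hpa hp₀a hp₀b).ne'
  rw [hPnL, v3_value_eq L p₀ hab, v3_value_eq L pₜ hab, ← mul_sub, ← mul_neg,
    mul_div_mul_left _ _ hL.ne', neg_sub, sub_div, div_self hne]
  ring
end

section
/- Under Uniswap V3 with liquidity L > 0 in the range [p_a, p_b], 0 < p_a < p_b, initial price p₀ ∈ (p_a, p_b) and current price p_t > 0, the borrowed P&L, defined as P&L_borrowed(p_t) = (p_t·x_t + y_t) − (p_t·x₀ + y₀), equals: −L·√p₀·(√(p_t/p₀) − 1)² if p_t ∈ (p_a, p_b); L·[p_t·(1/√p_a − 1/√p₀) − (√p₀ − √p_a)] if p_t ≤ p_a; and L·[(√p_b − √p₀) − p_t·(1/√p₀ − 1/√p_b)] if p_t ≥ p_b. -/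
/-- Uniswap V3 borrowed P&L: with liquidity `L > 0` on `[pa, pb]`, `0 < pa < pb`,
initial price `p₀ ∈ (pa, pb)` and current price `pₜ > 0`, the borrowed P&L
`(pₜ xₜ + yₜ) − (pₜ x₀ + y₀)` equals `−L √p₀ (√(pₜ/p₀) − 1)²` if `pₜ ∈ (pa, pb)`,
`L [pₜ (1/√pa − 1/√p₀) − (√p₀ − √pa)]` if `pₜ ≤ pa`, and
`L [(√pb − √p₀) − pₜ (1/√p₀ − 1/√pb)]` if `pₜ ≥ pb`. -/
theorem uniswapV3_borrowed_pnl (L pa pb p₀ pₜ : ℝ) (hL : 0 < L) (hpa : 0 < pa)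
    (hab : pa < pb) (hp₀a : pa < p₀) (hp₀b : p₀ < pb) (hpₜ : 0 < pₜ)
    (PnL : ℝ)
    (hPnL : PnL = (pₜ * v3x L pa pb pₜ + v3y L pa pb pₜ)
      - (pₜ * v3x L pa pb p₀ + v3y L pa pb p₀)) :
    (pa < pₜ → pₜ < pb →
      PnL = -(L * Real.sqrt p₀ * (Real.sqrt (pₜ / p₀) - 1) ^ 2)) ∧
    (pₜ ≤ pa →
      PnL = L * (pₜ * (1 / Real.sqrt pa - 1 / Real.sqrt p₀)
        - (Real.sqrt p₀ - Real.sqrt pa))) ∧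
    (pb ≤ pₜ →
      PnL = L * ((Real.sqrt pb - Real.sqrt p₀)
        - pₜ * (1 / Real.sqrt p₀ - 1 / Real.sqrt pb))) := by
  have x₀_eq : v3x L pa pb p₀ = L * (1 / Real.sqrt p₀ - 1 / Real.sqrt pb) := by
    simp only [v3x, if_neg hp₀a.not_ge, if_pos hp₀b]
  have y₀_eq : v3y L pa pb p₀ = L * (Real.sqrt p₀ - Real.sqrt pa) := by
    simp only [v3y, if_neg hp₀a.not_ge, if_pos hp₀b]
  rw [x₀_eq, y₀_eq] at hPnL
  subst hPnL
  refine ⟨fun h₁ h₂ => ?_, fun h => ?_, fun h => ?_⟩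
  · simp only [v3x, v3y, if_neg h₁.not_ge, if_pos h₂]
    have sqrt_p₀_pos : 0 < Real.sqrt p₀ := Real.sqrt_pos.2 (hpa.trans hp₀a)
    have sqrt_pₜ_pos : 0 < Real.sqrt pₜ := Real.sqrt_pos.2 hpₜ
    have sqrt_pb_pos : 0 < Real.sqrt pb := Real.sqrt_pos.2 (hpa.trans hab)
    have sq_pₜ : pₜ = Real.sqrt pₜ ^ 2 := (Real.sq_sqrt hpₜ.le).symm
    rw [Real.sqrt_div hpₜ.le]
    generalize Real.sqrt pₜ = s at *
    subst sq_pₜ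
    field_simp
    ring
  · simp only [v3x, v3y, if_pos h]
    ring
  · simp only [v3x, v3y, if_neg (hab.trans_le h).not_ge, if_neg h.not_gt]
    ring
end

section
/- The funded P&L per unit of liquidity under Uniswap V3 decomposes into a linear part, a square-root part and a vanilla/digital option part: for all p > 0, P&L_funded(p)/L = u₀(p) + u_{1/2}(p) + u₁(p), where u₀(p) = −p/√p_b + (p₀/√p_b − 2·√p₀), u_{1/2}(p) = 2·√p·1{p_a < p < p_b}, and u₁(p) = −(1/√p_a)·max(p_a − p, 0) + (1/√p_b)·max(p − p_b, 0) + 2·√p_a·1{p ≤ p_a} + 2·√p_b·1{p ≥ p_b}. -/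
open scoped Classical

/-- Decomposition of the Uniswap V3 funded P&L per unit of liquidity into a linear part,
a square-root part and a vanilla/digital option part: for all `p > 0`,
`P&L_funded(p)/L = u₀(p) + u_{1/2}(p) + u₁(p)`, where
`u₀(p) = −p/√pb + (p₀/√pb − 2√p₀)`, `u_{1/2}(p) = 2√p·1{pa < p < pb}`, and
`u₁(p) = −(1/√pa)·max(pa − p, 0) + (1/√pb)·max(p − pb, 0)
        + 2√pa·1{p ≤ pa} + 2√pb·1{p ≥ pb}`. -/
theorem uniswapV3_funded_pnl_decomposition (L pa pb p₀ : ℝ) (hL : 0 < L) (hpa : 0 < pa)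
    (hab : pa < pb) (hp₀a : pa < p₀) (hp₀b : p₀ < pb)
    (PnL : ℝ → ℝ)
    (hPnL : ∀ p : ℝ, PnL p =
      if p ≤ pa then
        L * (p * (1 / Real.sqrt pa - 1 / Real.sqrt pb)
          + p₀ / Real.sqrt pb - 2 * Real.sqrt p₀ + Real.sqrt pa)
      else if p < pb then
        L * (2 * (Real.sqrt p - Real.sqrt p₀) + (p₀ - p) / Real.sqrt pb)
      else
        L * (Real.sqrt pb + p₀ / Real.sqrt pb - 2 * Real.sqrt p₀)) :
    ∀ p : ℝ, 0 < p →
      PnL p / L =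
        (-(p / Real.sqrt pb) + (p₀ / Real.sqrt pb - 2 * Real.sqrt p₀))
        + (if pa < p ∧ p < pb then 2 * Real.sqrt p else 0)
        + (-(1 / Real.sqrt pa) * max (pa - p) 0 + (1 / Real.sqrt pb) * max (p - pb) 0
          + 2 * Real.sqrt pa * (if p ≤ pa then 1 else 0)
          + 2 * Real.sqrt pb * (if pb ≤ p then 1 else 0)) := by
  intro p _
  have ha : pa / Real.sqrt pa = Real.sqrt pa := Real.div_sqrt
  have hb : pb / Real.sqrt pb = Real.sqrt pb := Real.div_sqrt
  rw [hPnL]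
  rcases le_or_gt p pa with h | h
  · have hpb : p < pb := h.trans_lt hab
    rw [if_pos h, if_neg fun h' => h'.1.not_ge h, max_eq_left (sub_nonneg.2 h),
      max_eq_right (sub_nonpos.2 hpb.le), if_pos h, if_neg hpb.not_ge,
      mul_div_cancel_left₀ _ hL.ne']
    linear_combination ha
  · rw [if_neg h.not_ge, max_eq_right (sub_nonpos.2 h.le), if_neg h.not_ge]
    rcases lt_or_ge p pb with h' | h'
    · rw [if_pos h', if_pos ⟨h, h'⟩, max_eq_right (sub_nonpos.2 h'.le), if_neg h'.not_ge,
        mul_div_cancel_left₀ _ hL.ne']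
      ring
    · rw [if_neg h'.not_gt, if_neg fun h'' => h''.2.not_ge h', max_eq_left (sub_nonneg.2 h'),
        if_pos h', mul_div_cancel_left₀ _ hL.ne']
      linear_combination hb
end

section
/- The borrowed P&L per unit of liquidity under Uniswap V3 decomposes into a linear part, a square-root part and a vanilla/digital option part: for all p > 0, P&L_borrowed(p)/L = u₀(p) + u_{1/2}(p) + u₁(p), where u₀(p) = −p/√p₀ − √p₀, u_{1/2}(p) = 2·√p·1{p_a < p < p_b}, and u₁(p) = −(1/√p_a)·max(p_a − p, 0) + (1/√p_b)·max(p − p_b, 0) + 2·√p_a·1{p ≤ p_a} + 2·√p_b·1{p ≥ p_b}. -/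
open scoped Classical

/-- Decomposition of the Uniswap V3 borrowed P&L per unit of liquidity into a linear part,
a square-root part and a vanilla/digital option part: for all `p > 0`,
`P&L_borrowed(p)/L = u₀(p) + u_{1/2}(p) + u₁(p)`, where
`u₀(p) = −p/√p₀ − √p₀`, `u_{1/2}(p) = 2√p·1{pa < p < pb}`, and
`u₁(p) = −(1/√pa)·max(pa − p, 0) + (1/√pb)·max(p − pb, 0)
        + 2√pa·1{p ≤ pa} + 2√pb·1{p ≥ pb}`. -/
theorem uniswapV3_borrowed_pnl_decomposition (L pa pb p₀ : ℝ) (hL : 0 < L) (hpa : 0 < pa)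
    (hab : pa < pb) (hp₀a : pa < p₀) (hp₀b : p₀ < pb)
    (PnL : ℝ → ℝ)
    (hPnL : ∀ p : ℝ, PnL p =
      if p ≤ pa then
        L * (p * (1 / Real.sqrt pa - 1 / Real.sqrt p₀)
          - (Real.sqrt p₀ - Real.sqrt pa))
      else if p < pb then
        -(L * Real.sqrt p₀ * (Real.sqrt (p / p₀) - 1) ^ 2)
      else
        L * ((Real.sqrt pb - Real.sqrt p₀)
          - p * (1 / Real.sqrt p₀ - 1 / Real.sqrt pb))) :
    ∀ p : ℝ, 0 < p →
      PnL p / L =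
        (-(p / Real.sqrt p₀) - Real.sqrt p₀)
        + (if pa < p ∧ p < pb then 2 * Real.sqrt p else 0)
        + (-(1 / Real.sqrt pa) * max (pa - p) 0 + (1 / Real.sqrt pb) * max (p - pb) 0
          + 2 * Real.sqrt pa * (if p ≤ pa then 1 else 0)
          + 2 * Real.sqrt pb * (if pb ≤ p then 1 else 0)) := by
  intro p hp
  have hp₀ : 0 < p₀ := hpa.trans hp₀a
  have hpb : 0 < pb := hpa.trans hab
  have ha := Real.sqrt_pos.2 hpa
  have hb := Real.sqrt_pos.2 hpb
  have h₀ := Real.sqrt_pos.2 hp₀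
  have ha2 := Real.sq_sqrt hpa.le
  have hb2 := Real.sq_sqrt hpb.le
  have hp2 := Real.sq_sqrt hp.le
  rw [hPnL]
  rcases le_or_gt p pa with h | h
  · have hlt : p < pb := h.trans_lt hab
    rw [if_pos h, if_neg (fun hc => hc.1.not_ge h), if_pos h, if_neg hlt.not_ge,
      max_eq_left (sub_nonneg.2 h), max_eq_right (sub_nonpos.2 hlt.le),
      mul_div_cancel_left₀ _ hL.ne']
    field_simp
    linear_combination -√p₀ * √pb * ha2
  · rcases lt_or_ge p pb with h' | h'
    · rw [if_neg h.not_ge, if_pos h', if_pos ⟨h, h'⟩, if_neg h.not_ge, if_neg h'.not_ge,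
        max_eq_right (sub_nonpos.2 h.le), max_eq_right (sub_nonpos.2 h'.le),
        Real.sqrt_div hp.le, mul_assoc, ← mul_neg, mul_div_cancel_left₀ _ hL.ne']
      field_simp
      linear_combination -(√pa * √pb) * hp2
    · rw [if_neg h.not_ge, if_neg h'.not_gt, if_neg (fun hc => hc.2.not_ge h'),
        if_neg h.not_ge, if_pos h', max_eq_right (sub_nonpos.2 h.le),
        max_eq_left (sub_nonneg.2 h'), mul_div_cancel_left₀ _ hL.ne']
      field_simp
      linear_combination -√p₀ * √pa * hb2
end

section
/- The Uniswap V3 LP value per unit of liquidity admits the following representation in terms of square-root option payoffs: for all p > 0 and 0 < p_a < p_b, V(p)/L = p·max(1/√p − 1/√p_b, 0) − p·max(1/√p − 1/√p_a, 0) + max(√p − √p_a, 0) − max(√p − √p_b, 0), where V(p) = p·x(p) + y(p) is the value of the LP position at price p. -/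
theorem one_div_sqrt_le_one_div_sqrt {p q : ℝ} (hp : 0 < p) (hpq : p ≤ q) :
    1 / Real.sqrt q ≤ 1 / Real.sqrt p :=
  one_div_le_one_div_of_le (Real.sqrt_pos.2 hp) (Real.sqrt_le_sqrt hpq)

/-- The Uniswap V3 LP value per unit of liquidity as a combination of square-root
option payoffs: for all `p > 0` and `0 < pa < pb`,
`V(p)/L = p·max(1/√p − 1/√pb, 0) − p·max(1/√p − 1/√pa, 0)
        + max(√p − √pa, 0) − max(√p − √pb, 0)`,
where `V(p) = p·x(p) + y(p)` is the value of the LP position at price `p`. -/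
theorem uniswapV3_value_sqrt_payoffs (L pa pb : ℝ) (hL : 0 < L) (hpa : 0 < pa)
    (hab : pa < pb) :
    ∀ p : ℝ, 0 < p →
      (p * v3x L pa pb p + v3y L pa pb p) / L =
        p * max (1 / Real.sqrt p - 1 / Real.sqrt pb) 0
        - p * max (1 / Real.sqrt p - 1 / Real.sqrt pa) 0
        + max (Real.sqrt p - Real.sqrt pa) 0
        - max (Real.sqrt p - Real.sqrt pb) 0 := by
  intro p hp
  have hL' := hL.ne'
  unfold v3x v3y
  rcases le_or_gt p pa with h | h
  · have hb := h.trans hab.le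
    rw [if_pos h, if_pos h,
      max_eq_left (sub_nonneg.2 (one_div_sqrt_le_one_div_sqrt hp hb)),
      max_eq_left (sub_nonneg.2 (one_div_sqrt_le_one_div_sqrt hp h)),
      max_eq_right (sub_nonpos.2 (Real.sqrt_le_sqrt h)),
      max_eq_right (sub_nonpos.2 (Real.sqrt_le_sqrt hb)), div_eq_iff hL']
    ring
  · rw [if_neg h.not_ge, if_neg h.not_ge,
      max_eq_right (sub_nonpos.2 (one_div_sqrt_le_one_div_sqrt hpa h.le)),
      max_eq_left (sub_nonneg.2 (Real.sqrt_le_sqrt h.le))]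
    rcases lt_or_ge p pb with hb | hb
    · rw [if_pos hb, if_pos hb,
        max_eq_left (sub_nonneg.2 (one_div_sqrt_le_one_div_sqrt hp hb.le)),
        max_eq_right (sub_nonpos.2 (Real.sqrt_le_sqrt hb.le)), div_eq_iff hL']
      ring
    · rw [if_neg hb.not_gt, if_neg hb.not_gt,
        max_eq_right (sub_nonpos.2 (one_div_sqrt_le_one_div_sqrt (hpa.trans hab) hb)),
        max_eq_left (sub_nonneg.2 (Real.sqrt_le_sqrt hb)), div_eq_iff hL']
      ring
end

section
/- The Uniswap V3 LP value per unit of liquidity admits the following static replication by a continuum of vanilla options: for all p > 0 and 0 < p_a < p_b, V(p)/L = −(1/4)·∫_{p_a}^{p_b} k^{−3/2}·( max(k − p, 0) + max(p − k, 0) )·dk + (1/(2·√p_a))·( max(p − p_a, 0) − max(p_a − p, 0) ) + (1/(2·√p_b))·( max(p_b − p, 0) − max(p − p_b, 0) ), where V(p) = p·x(p) + y(p) is the value of the LP position at price p. -/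
open MeasureTheory intervalIntegral

theorem rpow_neg_three_halves_eq_inv_mul_sqrt {k : ℝ} (hk : 0 < k) :
    k ^ (-(3 : ℝ) / 2) = (k * √k)⁻¹ := by
  rw [Real.sqrt_eq_rpow, show -(3 : ℝ) / 2 = -(1 + 1 / 2) by norm_num, Real.rpow_neg hk.le,
    Real.rpow_add hk, Real.rpow_one]

theorem continuousOn_rpow_uIcc_of_pos {u v : ℝ} (hu : 0 < u) (huv : u ≤ v) (r : ℝ) :
    ContinuousOn (fun k : ℝ => k ^ r) (Set.uIcc u v) := by
  intro k hk
  rw [Set.uIcc_of_le huv] at hk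
  exact (Real.continuousAt_rpow_const k r (Or.inl (hu.trans_le hk.1).ne')).continuousWithinAt

/-- The weight `k ^ (-3/2)` against a linear payoff has primitive `2 * √k + 2 * p / √k`. -/
theorem integral_rpow_neg_three_halves_mul_sub {u v : ℝ} (p : ℝ) (hu : 0 < u) (huv : u ≤ v) :
    ∫ k in u..v, k ^ (-(3 : ℝ) / 2) * (k - p) =
      (2 * √v + 2 * p / √v) - (2 * √u + 2 * p / √u) := by
  refine integral_eq_sub_of_hasDerivAt (f := fun k => 2 * √k + 2 * p / √k) (fun k hk => ?_)
    (((continuousOn_rpow_uIcc_of_pos hu huv _).mul (by fun_prop)).intervalIntegrable)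
  rw [Set.uIcc_of_le huv] at hk
  have hk0 : 0 < k := hu.trans_le hk.1
  have hs : 0 < √k := Real.sqrt_pos.2 hk0
  have hd := Real.hasDerivAt_sqrt hk0.ne'
  refine ((hd.const_mul 2).add ((hasDerivAt_const k (2 * p)).div hd hs.ne')).congr_deriv ?_
  rw [rpow_neg_three_halves_eq_inv_mul_sqrt hk0, Real.sq_sqrt hk0.le]
  field_simp
  ring

theorem integral_rpow_neg_three_halves_mul_straddle_of_le {u v p : ℝ} (hu : 0 < u)
    (huv : u ≤ v) (hp : p ≤ u) :
    ∫ k in u..v, k ^ (-(3 : ℝ) / 2) * (max (k - p) 0 + max (p - k) 0) =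
      (2 * √v + 2 * p / √v) - (2 * √u + 2 * p / √u) := by
  rw [← integral_rpow_neg_three_halves_mul_sub p hu huv]
  refine integral_congr fun k hk => ?_
  rw [Set.uIcc_of_le huv] at hk
  have hpk := hp.trans hk.1
  simp [hpk]

theorem integral_rpow_neg_three_halves_mul_straddle_of_ge {u v p : ℝ} (hu : 0 < u)
    (huv : u ≤ v) (hp : v ≤ p) :
    ∫ k in u..v, k ^ (-(3 : ℝ) / 2) * (max (k - p) 0 + max (p - k) 0) =
      (2 * √u + 2 * p / √u) - (2 * √v + 2 * p / √v) := by
  rw [← neg_sub, ← integral_rpow_neg_three_halves_mul_sub p hu huv,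
    ← intervalIntegral.integral_neg]
  refine integral_congr fun k hk => ?_
  rw [Set.uIcc_of_le huv] at hk
  have hkp := hk.2.trans hp
  simp only [max_eq_right (sub_nonpos.2 hkp), max_eq_left (sub_nonneg.2 hkp)]
  ring

theorem intervalIntegrable_rpow_mul_straddle {u v : ℝ} (hu : 0 < u) (huv : u ≤ v) (p r : ℝ) :
    IntervalIntegrable (fun k : ℝ => k ^ r * (max (k - p) 0 + max (p - k) 0)) volume u v :=
  ((continuousOn_rpow_uIcc_of_pos hu huv r).mul (by fun_prop)).intervalIntegrable

/-- Static replication of the Uniswap V3 LP value per unit of liquidity by a continuum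
of vanilla options: for all `p > 0` and `0 < pa < pb`,
`V(p)/L = −(1/4)·∫_{pa}^{pb} k^{−3/2}·(max(k − p, 0) + max(p − k, 0))·dk
        + (1/(2√pa))·(max(p − pa, 0) − max(pa − p, 0))
        + (1/(2√pb))·(max(pb − p, 0) − max(p − pb, 0))`,
where `V(p) = p·x(p) + y(p)` is the value of the LP position at price `p`. -/
theorem uniswapV3_value_static_replication (L pa pb : ℝ) (hL : 0 < L) (hpa : 0 < pa)
    (hab : pa < pb) :
    ∀ p : ℝ, 0 < p →
      (p * v3x L pa pb p + v3y L pa pb p) / L =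
        -(1 / 4) * (∫ k in pa..pb, k ^ (-(3 : ℝ) / 2) * (max (k - p) 0 + max (p - k) 0))
        + (1 / (2 * Real.sqrt pa)) * (max (p - pa) 0 - max (pa - p) 0)
        + (1 / (2 * Real.sqrt pb)) * (max (pb - p) 0 - max (p - pb) 0) := by
  intro p hp
  have ha : 0 < √pa := Real.sqrt_pos.2 hpa
  have hb : 0 < √pb := Real.sqrt_pos.2 (hpa.trans hab)
  have hs : 0 < √p := Real.sqrt_pos.2 hp
  have ha2 : √pa ^ 2 = pa := Real.sq_sqrt hpa.le
  have hb2 : √pb ^ 2 = pb := Real.sq_sqrt (hpa.trans hab).le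
  have hs2 : √p ^ 2 = p := Real.sq_sqrt hp.le
  unfold v3x v3y
  rcases le_or_gt p pa with h | h
  · have h' := h.trans hab.le
    rw [if_pos h, if_pos h, integral_rpow_neg_three_halves_mul_straddle_of_le hpa hab.le h,
      max_eq_right (sub_nonpos.2 h), max_eq_left (sub_nonneg.2 h),
      max_eq_right (sub_nonpos.2 h'), max_eq_left (sub_nonneg.2 h')]
    generalize √pa = a at *
    generalize √pb = b at *
    subst ha2 hb2
    field_simp
    ring
  rw [if_neg h.not_ge, if_neg h.not_ge]
  rcases lt_or_ge p pb with h' | h'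
  · rw [if_pos h', if_pos h',
      ← integral_add_adjacent_intervals (intervalIntegrable_rpow_mul_straddle hpa h.le p _)
        (intervalIntegrable_rpow_mul_straddle hp h'.le p _),
      integral_rpow_neg_three_halves_mul_straddle_of_ge hpa h.le le_rfl,
      integral_rpow_neg_three_halves_mul_straddle_of_le hp h'.le le_rfl,
      max_eq_left (sub_nonneg.2 h.le), max_eq_right (sub_nonpos.2 h.le),
      max_eq_right (sub_nonpos.2 h'.le), max_eq_left (sub_nonneg.2 h'.le)]
    generalize √pa = a at *
    generalize √pb = b at *
    generalize √p = s at *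
    subst ha2 hb2 hs2
    field_simp
    ring
  · rw [if_neg h'.not_gt, if_neg h'.not_gt,
      integral_rpow_neg_three_halves_mul_straddle_of_ge hpa hab.le h',
      max_eq_left (sub_nonneg.2 h.le), max_eq_right (sub_nonpos.2 h.le),
      max_eq_right (sub_nonpos.2 h'), max_eq_left (sub_nonneg.2 h')]
    generalize √pa = a at *
    generalize √pb = b at *
    subst ha2 hb2
    field_simp
    ring
end

section
/- Static replication of an arbitrary IL function by vanilla puts matches slopes exactly at grid strikes: let IL : ℝ → ℝ be any function, let k₁ < k₂ < ... < k_N be strictly increasing strikes, define the divided differences δIL(k_n) = (IL(k_n) − IL(k_{n−1}))/(k_n − k_{n−1}) for n = 2, ..., N, and define portfolio weights by w_N = δIL(k_N), w_{n−1} = −(δIL(k_n) − δIL(k_{n−1})) for n = N, ..., 3, and w₁ = 0. Then the put portfolio payoff Π(K) = Σ_{n=1}^{N} w_n·max(k_n − K, 0) satisfies, for every n with 2 ≤ n ≤ N, (Π(k_n) − Π(k_{n−1}))/(k_n − k_{n−1}) = −δIL(k_n); in particular the portfolio payoff increments exactly offset the IL increments across every interior strike interval. -/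
/-- If `w N = δ N` and `w m = δ m - δ (m + 1)` for `n ≤ m < N`, the tail sum of `w`
from `n` to `N` telescopes to `δ n`. -/
theorem sum_Icc_eq_of_eq_sub_succ {G : Type*} [AddCommGroup G] {N n : ℕ} {δ w : ℕ → G}
    (hnN : n ≤ N) (hwN : w N = δ N) (hw : ∀ m, n ≤ m → m < N → w m = δ m - δ (m + 1)) :
    ∑ m ∈ Finset.Icc n N, w m = δ n := by
  induction hnN using Nat.decreasingInduction with
  | self => simpa using hwN
  | of_succ m hm ih =>
    have hIcc : Finset.Icc m N = insert m (Finset.Icc (m + 1) N) := by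
      ext x
      simp only [Finset.mem_Icc, Finset.mem_insert]
      omega
    rw [hIcc, Finset.sum_insert (by simp), ih fun x hx => hw x (by omega),
      hw m le_rfl hm, sub_add_cancel]

/-- The increment of a put payoff over the strike interval from `k n` to `k (n + 1)`. -/
theorem put_payoff_sub_put_payoff {N n m : ℕ} {k : ℕ → ℝ}
    (hk : MonotoneOn k (Set.Icc 1 N)) (hn : 1 ≤ n) (hnN : n < N)
    (hm : m ∈ Set.Icc 1 N) :
    max (k m - k (n + 1)) 0 - max (k m - k n) 0 =
      if n + 1 ≤ m then -(k (n + 1) - k n) else 0 := by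
  have hn' : n ∈ Set.Icc 1 N := ⟨hn, hnN.le⟩
  have hs : n + 1 ∈ Set.Icc 1 N := ⟨by omega, hnN⟩
  have hstep := hk hn' hs n.le_succ
  split_ifs with h
  · have := hk hs hm h
    rw [max_eq_left (by linarith), max_eq_left (by linarith)]
    ring
  · have := hk hm hn' (by omega)
    rw [max_eq_right (by linarith), max_eq_right (by linarith), sub_zero]

/-- Static replication of an arbitrary IL function by vanilla puts matches slopes
exactly at grid strikes: given strictly increasing strikes `k 1 < k 2 < ... < k N`,
divided differences `δ n = (IL (k n) − IL (k (n−1)))/(k n − k (n−1))` for `2 ≤ n ≤ N`,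
and weights `w N = δ N`, `w (n−1) = −(δ n − δ (n−1))` for `3 ≤ n ≤ N`, `w 1 = 0`,
the put portfolio `Π(K) = Σ_{n=1}^{N} w n · max (k n − K) 0` satisfies, for every
`2 ≤ n ≤ N`, `(Π (k n) − Π (k (n−1)))/(k n − k (n−1)) = −δ n`. -/
theorem put_portfolio_matches_IL_slopes (N : ℕ) (hN : 2 ≤ N)
    (IL : ℝ → ℝ) (k : ℕ → ℝ)
    (hk : ∀ n : ℕ, 1 ≤ n → n < N → k n < k (n + 1))
    (δ w : ℕ → ℝ)
    (hδ : ∀ n : ℕ, 2 ≤ n → n ≤ N →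
      δ n = (IL (k n) - IL (k (n - 1))) / (k n - k (n - 1)))
    (hwN : w N = δ N)
    (hw : ∀ n : ℕ, 3 ≤ n → n ≤ N → w (n - 1) = -(δ n - δ (n - 1)))
    (hw1 : w 1 = 0)
    (Port : ℝ → ℝ)
    (hPort : ∀ K : ℝ, Port K = ∑ n ∈ Finset.Icc 1 N, w n * max (k n - K) 0) :
    ∀ n : ℕ, 2 ≤ n → n ≤ N →
      (Port (k n) - Port (k (n - 1))) / (k n - k (n - 1)) = -δ n := by
  intro n hn hnN
  obtain ⟨n, rfl⟩ : ∃ j, n = j + 1 := ⟨n - 1, by omega⟩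
  rw [Nat.add_sub_cancel]
  have hmono : MonotoneOn k (Set.Icc 1 N) :=
    monotoneOn_of_le_succ Set.ordConnected_Icc fun a _ ha ha' =>
      (hk a ha.1 (Nat.lt_of_succ_le ha'.2)).le
  have htail : ∑ m ∈ Finset.Icc (n + 1) N, w m = δ (n + 1) := by
    refine sum_Icc_eq_of_eq_sub_succ hnN hwN fun m hm hmN => ?_
    have := hw (m + 1) (by omega) hmN
    rw [Nat.add_sub_cancel] at this
    rw [this, neg_sub]
  have hfilter : (Finset.Icc 1 N).filter (n + 1 ≤ ·) = Finset.Icc (n + 1) N := by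
    ext x
    simp only [Finset.mem_filter, Finset.mem_Icc]
    omega
  have hdiff : Port (k (n + 1)) - Port (k n) = -δ (n + 1) * (k (n + 1) - k n) := by
    rw [hPort, hPort, ← Finset.sum_sub_distrib]
    calc
      _ = ∑ m ∈ Finset.Icc 1 N, if n + 1 ≤ m then w m * -(k (n + 1) - k n) else 0 := by
        refine Finset.sum_congr rfl fun m hm => ?_
        rw [← mul_sub, put_payoff_sub_put_payoff hmono (by omega) hnN (Finset.mem_Icc.1 hm),
          mul_ite, mul_zero]
      _ = -δ (n + 1) * (k (n + 1) - k n) := by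
        rw [← Finset.sum_filter, hfilter, ← Finset.sum_mul, htail]
        ring
  rw [hdiff, mul_div_cancel_right₀ _ (sub_pos.2 (hk n (by omega) hnN)).ne']
end

section
/- Under the Black–Scholes–Merton model, the present value at time t of the IL protection claims for Uniswap V2 are: PV_funded(t, p_t) = e^{−rτ}·(1 − e^{x_t/2}·G), and PV_borrowed(t, p_t) = (1/2)·e^{−rτ}·(e^{x_t + μτ} − 2·e^{x_t/2}·G + 1), where G = exp( (1/2)·(μ − σ²/2)·τ + (1/8)·σ²·τ ). Equivalently, for X a Gaussian random variable with mean (μ − σ²/2)·τ and variance σ²·τ, E[e^{X/2}] = G and E[e^{X}] = e^{μτ}, so that e^{−rτ}·E[1 − e^{(x_t + X)/2}] = e^{−rτ}·(1 − e^{x_t/2}·G) and e^{−rτ}·E[(1/2)·(e^{(x_t + X)/2} − 1)²] = (1/2)·e^{−rτ}·(e^{x_t + μτ} − 2·e^{x_t/2}·G + 1). -/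
open ProbabilityTheory MeasureTheory

/-- The exponential moments of a real Gaussian random variable. -/
lemma integral_exp_mul_gaussianReal (m : ℝ) {v : ℝ} (hv : 0 ≤ v) (c : ℝ) :
    ∫ x, Real.exp (c * x) ∂(gaussianReal m v.toNNReal) = Real.exp (m * c + v * c ^ 2 / 2) := by
  have h := congrFun (mgf_id_gaussianReal (μ := m) (v := v.toNNReal)) c
  simpa only [mgf, id, Real.coe_toNNReal v hv] using h

/-- Black–Scholes–Merton values of the Uniswap V2 IL protection claims: with
`μ = r − q`, `G = exp((1/2)(μ − σ²/2)τ + (1/8)σ²τ)` and the log-return over the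
remaining time `X ~ Normal((μ − σ²/2)τ, σ²τ)`, one has `E[e^{X/2}] = G`,
`E[e^{X}] = e^{μτ}`, and hence
`PV_funded = e^{−rτ}·E[1 − e^{(xₜ + X)/2}] = e^{−rτ}(1 − e^{xₜ/2}·G)` and
`PV_borrowed = e^{−rτ}·E[(1/2)(e^{(xₜ + X)/2} − 1)²]
             = (1/2)e^{−rτ}(e^{xₜ + μτ} − 2e^{xₜ/2}·G + 1)`. -/
theorem bsm_uniswapV2_protection_values (r q σ τ xₜ μ G : ℝ)
    (hσ : 0 < σ) (hτ : 0 < τ) (hμ : μ = r - q)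
    (hG : G = Real.exp ((1 / 2) * (μ - σ ^ 2 / 2) * τ + (1 / 8) * σ ^ 2 * τ)) :
    (∫ x, Real.exp (x / 2)
        ∂(gaussianReal ((μ - σ ^ 2 / 2) * τ) ((σ ^ 2 * τ).toNNReal)) = G) ∧
    (∫ x, Real.exp x
        ∂(gaussianReal ((μ - σ ^ 2 / 2) * τ) ((σ ^ 2 * τ).toNNReal))
      = Real.exp (μ * τ)) ∧
    (Real.exp (-r * τ) *
        ∫ x, (1 - Real.exp ((xₜ + x) / 2))
          ∂(gaussianReal ((μ - σ ^ 2 / 2) * τ) ((σ ^ 2 * τ).toNNReal))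
      = Real.exp (-r * τ) * (1 - Real.exp (xₜ / 2) * G)) ∧
    (Real.exp (-r * τ) *
        ∫ x, (1 / 2) * (Real.exp ((xₜ + x) / 2) - 1) ^ 2
          ∂(gaussianReal ((μ - σ ^ 2 / 2) * τ) ((σ ^ 2 * τ).toNNReal))
      = (1 / 2) * Real.exp (-r * τ) *
          (Real.exp (xₜ + μ * τ) - 2 * Real.exp (xₜ / 2) * G + 1)) := by
  have hv : 0 ≤ σ ^ 2 * τ := by positivity
  set γ := gaussianReal ((μ - σ ^ 2 / 2) * τ) ((σ ^ 2 * τ).toNNReal) with hγ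
  have hhalf : ∫ x, Real.exp (x / 2) ∂γ = G := by
    have h := integral_exp_mul_gaussianReal ((μ - σ ^ 2 / 2) * τ) hv (1 / 2)
    rw [hG, hγ]
    convert h using 2
    · ext x
      ring_nf
    · ring
  have hone : ∫ x, Real.exp x ∂γ = Real.exp (μ * τ) := by
    have h := integral_exp_mul_gaussianReal ((μ - σ ^ 2 / 2) * τ) hv 1
    rw [hγ]
    convert h using 2
    · ext x
      ring_nf
    · ring
  have ihalf : Integrable (fun x ↦ Real.exp (x / 2)) γ := by
    convert integrable_exp_mul_gaussianReal (1 / 2) using 3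
    ring
  have ione : Integrable (fun x ↦ Real.exp x) γ := by
    simpa only [one_mul] using
      integrable_exp_mul_gaussianReal (μ := (μ - σ ^ 2 / 2) * τ) (v := (σ ^ 2 * τ).toNNReal) 1
  have split (x : ℝ) : Real.exp ((xₜ + x) / 2) = Real.exp (xₜ / 2) * Real.exp (x / 2) := by
    rw [← Real.exp_add, add_div]
  refine ⟨hhalf, hone, ?_, ?_⟩
  · simp_rw [split]
    rw [integral_sub (integrable_const _) (ihalf.const_mul _), integral_const_mul, hhalf]
    simp
  · have expand (x : ℝ) : (Real.exp ((xₜ + x) / 2) - 1) ^ 2 =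
        Real.exp xₜ * Real.exp x - 2 * Real.exp (xₜ / 2) * Real.exp (x / 2) + 1 := by
      have hsq : Real.exp ((xₜ + x) / 2) ^ 2 = Real.exp xₜ * Real.exp x := by
        rw [← Real.exp_nat_mul, ← Real.exp_add]
        congr 1
        push_cast
        ring
      rw [sub_sq, hsq, split]
      ring
    have idiff : Integrable (fun x ↦ Real.exp xₜ * Real.exp x -
        2 * Real.exp (xₜ / 2) * Real.exp (x / 2)) γ :=
      (ione.const_mul _).sub (ihalf.const_mul _)
    simp_rw [expand]
    rw [integral_const_mul,
      integral_add idiff (integrable_const _),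
      integral_sub (ione.const_mul _) (ihalf.const_mul _), integral_const_mul,
      integral_const_mul, hhalf, hone, Real.exp_add]
    simp only [integral_const, probReal_univ, smul_eq_mul]
    ring
end

section
/- Under the Black–Scholes–Merton model, the value of the square-root range claim equals U_{1/2}(p_t) = e^{−rτ}·√p_t·exp( (1/2)·μ·τ − (1/8)·σ²·τ )·( Φ( (ln(p_b/p_t) − μτ)/(σ·√τ) ) − Φ( (ln(p_a/p_t) − μτ)/(σ·√τ) ) ). Equivalently, for X a Gaussian random variable with mean (μ − σ²/2)·τ and variance σ²·τ and for any real a < b, E[ e^{X/2}·1{a < X < b} ] = exp( (1/2)·(μ − σ²/2)·τ + (1/8)·σ²·τ )·( Φ( (b − μτ)/(σ·√τ) ) − Φ( (a − μτ)/(σ·√τ) ) ). -/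
open ProbabilityTheory MeasureTheory

/-- The standard normal cumulative distribution function `Φ`. -/
noncomputable def stdNormalCDF (x : ℝ) : ℝ :=
  ((gaussianReal 0 1) (Set.Iic x)).toReal

open scoped NNReal

/-- Exponential tilting of a Gaussian: weighting by `exp (t * x)` shifts the mean by `v * t`. -/
theorem setIntegral_exp_mul_gaussianReal (m t : ℝ) {v : ℝ≥0} (hv : v ≠ 0) {s : Set ℝ}
    (hs : MeasurableSet s) :
    ∫ x in s, Real.exp (t * x) ∂(gaussianReal m v)
      = Real.exp (m * t + v * t ^ 2 / 2) * (gaussianReal (m + v * t) v).real s := by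
  have hv' : (v : ℝ) ≠ 0 := by exact_mod_cast hv
  rw [← integral_indicator hs, integral_gaussianReal_eq_integral_smul hv, measureReal_def,
    gaussianReal_apply_eq_integral _ hv, ENNReal.toReal_ofReal
      (integral_nonneg fun x => gaussianPDFReal_nonneg _ _ _),
    ← integral_const_mul, ← integral_indicator hs]
  congr 1 with x
  by_cases hx : x ∈ s
  · simp only [Set.indicator_of_mem hx, smul_eq_mul, gaussianPDFReal]
    rw [mul_assoc, mul_left_comm (Real.exp (m * t + v * t ^ 2 / 2)), ← Real.exp_add,
      ← Real.exp_add]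
    congr 2
    field_simp
    ring
  · simp [Set.indicator_of_notMem hx]

theorem gaussianReal_Iic_eq_stdNormalCDF (m x : ℝ) {s : ℝ} (hs : 0 < s) :
    (gaussianReal m (s ^ 2).toNNReal).real (Set.Iic x) = stdNormalCDF ((x - m) / s) := by
  have hmap : (gaussianReal m (s ^ 2).toNNReal)
      = (gaussianReal 0 1).map (fun y => s * y + m) := by
    have h : (fun y => s * y + m) = (fun y => y + m) ∘ (fun y => s * y) := rfl
    rw [h, ← Measure.map_map (by fun_prop) (by fun_prop), gaussianReal_map_const_mul,
      gaussianReal_map_add_const]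
    congr 1
    · simp
    · rw [mul_one]
      exact NNReal.eq (Real.coe_toNNReal _ (sq_nonneg s))
  rw [hmap, measureReal_def, Measure.map_apply (by fun_prop) measurableSet_Iic, stdNormalCDF]
  congr 2
  ext y
  simp only [Set.mem_preimage, Set.mem_Iic]
  rw [le_div_iff₀ hs, le_sub_iff_add_le, mul_comm]

theorem gaussianReal_Ioo_eq_stdNormalCDF_sub (m : ℝ) {s a b : ℝ} (hs : 0 < s) (hab : a < b) :
    (gaussianReal m (s ^ 2).toNNReal).real (Set.Ioo a b)
      = stdNormalCDF ((b - m) / s) - stdNormalCDF ((a - m) / s) := by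
  have : NullSingletonClass (gaussianReal m (s ^ 2).toNNReal) :=
    nullSingletonClass_gaussianReal (Real.toNNReal_pos.2 (by positivity)).ne'
  rw [measureReal_congr (Ioo_ae_eq_Ioc (μ := gaussianReal m (s ^ 2).toNNReal)),
    ← Set.Iic_sdiff_Iic, measureReal_sdiff (Set.Iic_subset_Iic.2 hab.le) measurableSet_Iic,
    gaussianReal_Iic_eq_stdNormalCDF m b hs, gaussianReal_Iic_eq_stdNormalCDF m a hs]

theorem setIntegral_Ioo_exp_half_gaussianReal (μ : ℝ) {σ τ a b : ℝ} (hσ : 0 < σ) (hτ : 0 < τ)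
    (hab : a < b) :
    ∫ x in Set.Ioo a b, Real.exp (x / 2)
        ∂(gaussianReal ((μ - σ ^ 2 / 2) * τ) ((σ ^ 2 * τ).toNNReal))
      = Real.exp ((1 / 2) * (μ - σ ^ 2 / 2) * τ + (1 / 8) * σ ^ 2 * τ) *
          (stdNormalCDF ((b - μ * τ) / (σ * Real.sqrt τ))
            - stdNormalCDF ((a - μ * τ) / (σ * Real.sqrt τ))) := by
  have hs : 0 < σ * Real.sqrt τ := by positivity
  have hv : σ ^ 2 * τ = (σ * Real.sqrt τ) ^ 2 := by rw [mul_pow, Real.sq_sqrt hτ.le]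
  have h := setIntegral_exp_mul_gaussianReal ((μ - σ ^ 2 / 2) * τ) (1 / 2)
    (v := (σ ^ 2 * τ).toNNReal) (Real.toNNReal_pos.2 (by positivity)).ne'
    (measurableSet_Ioo (a := a) (b := b))
  rw [Real.coe_toNNReal _ (by positivity),
    show (μ - σ ^ 2 / 2) * τ + σ ^ 2 * τ * (1 / 2) = μ * τ by ring] at h
  rw [← gaussianReal_Ioo_eq_stdNormalCDF_sub _ hs hab, ← hv]
  convert h using 2
  · ext x
    ring_nf
  · ring_nf

/-- Black–Scholes–Merton value of the square-root range claim: with `μ = r − q`,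
`σ > 0`, `τ > 0` and the log-return `X ~ Normal((μ − σ²/2)τ, σ²τ)`, for any `a < b`,
`E[e^{X/2}·1{a < X < b}]
  = exp((1/2)(μ − σ²/2)τ + (1/8)σ²τ)·(Φ((b − μτ)/(σ√τ)) − Φ((a − μτ)/(σ√τ)))`,
and consequently, for `0 < pa < pb` and `pₜ > 0`,
`U_{1/2}(pₜ) = e^{−rτ}·E[√(pₜ e^{X})·1{ln(pa/pₜ) < X < ln(pb/pₜ)}]
  = e^{−rτ}·√pₜ·exp((1/2)μτ − (1/8)σ²τ)·
    (Φ((ln(pb/pₜ) − μτ)/(σ√τ)) − Φ((ln(pa/pₜ) − μτ)/(σ√τ)))`. -/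
theorem bsm_sqrt_range_claim_value (r q σ τ μ a b pa pb pₜ : ℝ)
    (hσ : 0 < σ) (hτ : 0 < τ) (hμ : μ = r - q) (hab : a < b)
    (hpa : 0 < pa) (hpb : pa < pb) (hpₜ : 0 < pₜ) :
    (∫ x in Set.Ioo a b, Real.exp (x / 2)
        ∂(gaussianReal ((μ - σ ^ 2 / 2) * τ) ((σ ^ 2 * τ).toNNReal))
      = Real.exp ((1 / 2) * (μ - σ ^ 2 / 2) * τ + (1 / 8) * σ ^ 2 * τ) *
          (stdNormalCDF ((b - μ * τ) / (σ * Real.sqrt τ))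
            - stdNormalCDF ((a - μ * τ) / (σ * Real.sqrt τ)))) ∧
    (Real.exp (-r * τ) *
        ∫ x in Set.Ioo (Real.log (pa / pₜ)) (Real.log (pb / pₜ)),
          Real.sqrt (pₜ * Real.exp x)
          ∂(gaussianReal ((μ - σ ^ 2 / 2) * τ) ((σ ^ 2 * τ).toNNReal))
      = Real.exp (-r * τ) * Real.sqrt pₜ *
          Real.exp ((1 / 2) * μ * τ - (1 / 8) * σ ^ 2 * τ) *
          (stdNormalCDF ((Real.log (pb / pₜ) - μ * τ) / (σ * Real.sqrt τ))
            - stdNormalCDF ((Real.log (pa / pₜ) - μ * τ) / (σ * Real.sqrt τ)))) := by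
  refine ⟨setIntegral_Ioo_exp_half_gaussianReal μ hσ hτ hab, ?_⟩
  have hlog : Real.log (pa / pₜ) < Real.log (pb / pₜ) :=
    Real.log_lt_log (by positivity) (by gcongr)
  have hsqrt : ∀ x, Real.sqrt (pₜ * Real.exp x) = Real.sqrt pₜ * Real.exp (x / 2) := fun x => by
    rw [Real.sqrt_mul hpₜ.le, Real.exp_half]
  simp_rw [hsqrt]
  rw [integral_const_mul, setIntegral_Ioo_exp_half_gaussianReal μ hσ hτ hlog,
    show (1 / 2) * (μ - σ ^ 2 / 2) * τ + (1 / 8) * σ ^ 2 * τ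
      = (1 / 2) * μ * τ - (1 / 8) * σ ^ 2 * τ by ring]
  ring
end

section
/- The delta (price sensitivity) of the Black–Scholes–Merton value of the square-root range claim is given in closed form: for the function F(p) = √p·exp( (1/2)·μ·τ − (1/8)·σ²·τ )·( Φ(d_b(p)) − Φ(d_a(p)) ) with d_b(p) = (ln(p_b/p) − μτ)/(σ·√τ) and d_a(p) = (ln(p_a/p) − μτ)/(σ·√τ), the derivative with respect to p > 0 equals F′(p) = (1/(2·√p))·exp( (1/2)·μ·τ − (1/8)·σ²·τ )·( Φ(d_b(p)) − Φ(d_a(p)) ) − (1/(σ·√τ·√p))·exp( (1/2)·μ·τ − (1/8)·σ²·τ )·( φ(d_b(p)) − φ(d_a(p)) ), where φ is the standard normal density. -/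
open ProbabilityTheory MeasureTheory

/-- The standard normal density `φ`. -/
noncomputable def stdNormalPDF (x : ℝ) : ℝ :=
  Real.exp (-x ^ 2 / 2) / Real.sqrt (2 * Real.pi)

theorem stdNormalPDF_eq_gaussianPDFReal (x : ℝ) :
    stdNormalPDF x = gaussianPDFReal 0 1 x := by
  simp [stdNormalPDF, gaussianPDFReal, div_eq_inv_mul]

theorem stdNormalCDF_eq_integral (x : ℝ) :
    stdNormalCDF x = ∫ t in Set.Iic x, gaussianPDFReal 0 1 t := by
  rw [stdNormalCDF, gaussianReal_apply_eq_integral 0 one_ne_zero]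
  exact ENNReal.toReal_ofReal (integral_nonneg (gaussianPDFReal_nonneg 0 1))

theorem continuous_stdNormalPDF : Continuous stdNormalPDF := by
  unfold stdNormalPDF
  fun_prop

theorem hasDerivAt_stdNormalCDF (x : ℝ) :
    HasDerivAt stdNormalCDF (stdNormalPDF x) x := by
  have hint : Integrable stdNormalPDF := by
    simpa only [← funext stdNormalPDF_eq_gaussianPDFReal] using integrable_gaussianPDFReal 0 1
  have hcdf : stdNormalCDF = fun y => stdNormalCDF 0 + ∫ t in (0 : ℝ)..y, stdNormalPDF t := by
    funext y
    rw [← intervalIntegral.integral_Iic_sub_Iic hint.integrableOn hint.integrableOn]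
    simp only [stdNormalCDF_eq_integral, stdNormalPDF_eq_gaussianPDFReal]
    ring
  rw [hcdf]
  exact (continuous_stdNormalPDF.integral_hasStrictDerivAt 0 x).hasDerivAt.const_add _

theorem hasDerivAt_log_div_sub_div {a p : ℝ} (ha : a ≠ 0) (hp : p ≠ 0) (b c : ℝ) :
    HasDerivAt (fun q : ℝ => (Real.log (a / q) - b) / c) (-p⁻¹ / c) p := by
  have h : HasDerivAt (fun q : ℝ => Real.log (a / q)) (-p⁻¹) p := by
    refine (((hasDerivAt_inv hp).const_mul a).log
      (mul_ne_zero ha (inv_ne_zero hp))).congr_deriv ?_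
    field_simp
  exact (h.sub_const b).div_const c

/-- Delta of the Black–Scholes–Merton value of the square-root range claim: for
`F(p) = √p·exp((1/2)μτ − (1/8)σ²τ)·(Φ(d_b(p)) − Φ(d_a(p)))` with
`d_b(p) = (ln(pb/p) − μτ)/(σ√τ)` and `d_a(p) = (ln(pa/p) − μτ)/(σ√τ)`, the
derivative at any `p > 0` equals
`F′(p) = (1/(2√p))·exp((1/2)μτ − (1/8)σ²τ)·(Φ(d_b(p)) − Φ(d_a(p)))
       − (1/(σ√τ·√p))·exp((1/2)μτ − (1/8)σ²τ)·(φ(d_b(p)) − φ(d_a(p)))`. -/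
theorem bsm_sqrt_range_claim_delta (μ σ τ pa pb : ℝ)
    (hσ : 0 < σ) (hτ : 0 < τ) (hpa : 0 < pa) (hab : pa < pb)
    (p : ℝ) (hp : 0 < p) :
    HasDerivAt
      (fun q : ℝ =>
        Real.sqrt q * Real.exp ((1 / 2) * μ * τ - (1 / 8) * σ ^ 2 * τ) *
          (stdNormalCDF ((Real.log (pb / q) - μ * τ) / (σ * Real.sqrt τ))
            - stdNormalCDF ((Real.log (pa / q) - μ * τ) / (σ * Real.sqrt τ))))
      ((1 / (2 * Real.sqrt p)) * Real.exp ((1 / 2) * μ * τ - (1 / 8) * σ ^ 2 * τ) *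
          (stdNormalCDF ((Real.log (pb / p) - μ * τ) / (σ * Real.sqrt τ))
            - stdNormalCDF ((Real.log (pa / p) - μ * τ) / (σ * Real.sqrt τ)))
        - (1 / (σ * Real.sqrt τ * Real.sqrt p)) *
            Real.exp ((1 / 2) * μ * τ - (1 / 8) * σ ^ 2 * τ) *
            (stdNormalPDF ((Real.log (pb / p) - μ * τ) / (σ * Real.sqrt τ))
              - stdNormalPDF ((Real.log (pa / p) - μ * τ) / (σ * Real.sqrt τ))))
      p := by
  have hs : Real.sqrt p ≠ 0 := (Real.sqrt_pos.2 hp).ne'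
  have ht : Real.sqrt τ ≠ 0 := (Real.sqrt_pos.2 hτ).ne'
  have hd (a : ℝ) (ha : 0 < a) :=
    (hasDerivAt_stdNormalCDF ((Real.log (a / p) - μ * τ) / (σ * Real.sqrt τ))).comp p
      (hasDerivAt_log_div_sub_div ha.ne' hp.ne' (μ * τ) (σ * Real.sqrt τ))
  have hinv : p⁻¹ = (Real.sqrt p)⁻¹ * (Real.sqrt p)⁻¹ := by
    rw [← mul_inv, Real.mul_self_sqrt hp.le]
  refine (((Real.hasDerivAt_sqrt hp.ne').mul_const
    (Real.exp ((1 / 2) * μ * τ - (1 / 8) * σ ^ 2 * τ))).mul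
      ((hd pb (hpa.trans hab)).sub (hd pa hpa))).congr_deriv ?_
  rw [hinv]
  simp only [Pi.sub_apply, Function.comp_apply]
  field_simp
  ring
end
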